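/- Let f be a piecewise affine orientation-preserving homeomorphism of the circle ℝ/ℤ with finitely many break points. Then either f has a periodic point, or f is minimal (every orbit {fⁿ(x) : n ∈ ℤ} is dense in ℝ/ℤ). -/

import Mathlib

open Filter

/-- The circle `ℝ/ℤ`. -/
abbrev Circle1 : Type := AddCircle (1 : ℝ)

/-- `F : ℝ → ℝ` is a lift of an orientation-preserving circle homeomorphism:
continuous, strictly increasing, commuting with the unit translation. -/
def IsLift (F : ℝ → ℝ) : Prop :=
  Continuous F ∧ StrictMono F ∧ ∀ x : ℝ, F (x + 1) = F x + 1

/-- The circle map `f` is induced by the lift `F`. -/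
def Induces (F : ℝ → ℝ) (f : Circle1 → Circle1) : Prop :=
  ∀ x : ℝ, f ((x : ℝ) : Circle1) = ((F x : ℝ) : Circle1)

/-- The set `B + ℤ` of lifts of the break points. -/
def BreakLattice (B : Set ℝ) : Set ℝ :=
  {z : ℝ | ∃ b ∈ B, ∃ n : ℤ, z = b + n}

/-- `F` is affine on each connected component of `ℝ \ (B + ℤ)`: it is affine on every
connected subset of `ℝ` disjoint from `B + ℤ`. -/
def PiecewiseAffineLift (F : ℝ → ℝ) (B : Set ℝ) : Prop :=
  ∀ s : Set ℝ, IsPreconnected s → Disjoint s (BreakLattice B) →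
    ∃ a c : ℝ, ∀ x ∈ s, F x = a * x + c

/-- A circle homeomorphism `f` is minimal if every (two-sided) orbit
`{fⁿ(x) : n ∈ ℤ}` is dense.  For a bijection `f`, the point `y` lies on the
`ℤ`-orbit of `x` iff `f^[n] x = y` or `f^[n] y = x` for some natural `n`. -/
def MinimalCircleMap (f : Circle1 → Circle1) : Prop :=
  ∀ x : Circle1, Dense {y : Circle1 | ∃ n : ℕ, f^[n] x = y ∨ f^[n] y = x}

/-- A continuous strictly increasing function which is affine off a finite set has slopes bounded
away from zero and infinity on a compact interval. -/
lemma exists_slope_bounds {F : ℝ → ℝ} (hc : Continuous F) (hm : StrictMono F) (S : Finset ℝ) :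
    ∀ c d : ℝ, c < d →
      (∀ s ⊆ Set.Ioo c d, IsPreconnected s → Disjoint s (S : Set ℝ) →
        ∃ α γ : ℝ, ∀ x ∈ s, F x = α * x + γ) →
      ∃ l > 0, ∃ u : ℝ, ∀ x y, c ≤ x → x ≤ y → y ≤ d →
        l * (y - x) ≤ F y - F x ∧ F y - F x ≤ u * (y - x) := by
  induction S using Finset.induction_on with
  | empty =>
    intro c d hcd h
    obtain ⟨α, γ, hα⟩ := h (Set.Ioo c d) subset_rfl isPreconnected_Ioo (by simp)
    have hcl : Set.EqOn F (fun x => α * x + γ) (Set.Icc c d) := by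
      rw [← closure_Ioo hcd.ne]
      exact Set.EqOn.closure hα hc (by fun_prop)
    have hpos : 0 < α := by
      have h1 := hm hcd
      rw [hcl (Set.left_mem_Icc.2 hcd.le), hcl (Set.right_mem_Icc.2 hcd.le)] at h1
      by_contra! hneg
      nlinarith
    refine ⟨α, hpos, α, fun x y hx hxy hy => ?_⟩
    rw [hcl ⟨hx, hxy.trans hy⟩, hcl ⟨hx.trans hxy, hy⟩]
    constructor <;> apply le_of_eq <;> ring
  | insert t S _ ih =>
    intro c d hcd h
    by_cases ht : t ∈ Set.Ioo c d
    · obtain ⟨l₁, hl₁, u₁, h₁⟩ := ih c t ht.1 fun s hs hp hd => by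
        refine h s (hs.trans (Set.Ioo_subset_Ioo_right ht.2.le)) hp ?_
        rw [Finset.coe_insert, Set.disjoint_insert_right]
        exact ⟨fun hts => lt_irrefl _ (hs hts).2, hd⟩
      obtain ⟨l₂, hl₂, u₂, h₂⟩ := ih t d ht.2 fun s hs hp hd => by
        refine h s (hs.trans (Set.Ioo_subset_Ioo_left ht.1.le)) hp ?_
        rw [Finset.coe_insert, Set.disjoint_insert_right]
        exact ⟨fun hts => lt_irrefl _ (hs hts).1, hd⟩
      refine ⟨min l₁ l₂, lt_min hl₁ hl₂, max u₁ u₂, fun x y hx hxy hy => ?_⟩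
      have b₁ := min_le_left l₁ l₂
      have b₂ := min_le_right l₁ l₂
      have b₃ := le_max_left u₁ u₂
      have b₄ := le_max_right u₁ u₂
      rcases le_total y t with hyt | hty
      · have := h₁ x y hx hxy hyt
        constructor <;> nlinarith
      rcases le_total t x with htx | hxt
      · have := h₂ x y htx hxy hy
        constructor <;> nlinarith
      · have i₁ := h₁ x t hx hxt le_rfl
        have i₂ := h₂ t y le_rfl hty hy
        constructor <;> nlinarith
    · refine ih c d hcd fun s hs hp hd => h s hs hp ?_
      rw [Finset.coe_insert, Set.disjoint_insert_right]
      exact ⟨fun hts => ht (hs hts), hd⟩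

lemma PiecewiseAffineLift.exists_slope_bounds {F : ℝ → ℝ} {B : Set ℝ} (hBfin : B.Finite)
    (hB : B ⊆ Set.Ico (0 : ℝ) 1) (hF : IsLift F) (hPA : PiecewiseAffineLift F B) :
    ∃ l > 0, ∃ u : ℝ, ∀ x y, 0 ≤ x → x ≤ y → y ≤ 2 →
      l * (y - x) ≤ F y - F x ∧ F y - F x ≤ u * (y - x) := by
  classical
  have hfin : (B ∪ (· + 1) '' B).Finite := hBfin.union (hBfin.image _)
  refine _root_.exists_slope_bounds hF.1 hF.2.1 hfin.toFinset 0 2 two_pos fun s hs hp hd => ?_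
  refine hPA s hp (Set.disjoint_left.2 ?_)
  rintro _ hzs ⟨b, hb, n, rfl⟩
  have h1 := hs hzs
  have h2 := hB hb
  refine Set.disjoint_left.1 hd hzs ?_
  rw [Set.Finite.coe_toFinset]
  have hn1 : -1 < n := by
    have : (-1 : ℝ) < n := by linarith [h1.1, h2.2]
    exact_mod_cast this
  have hn2 : n < 2 := by
    have : (n : ℝ) < 2 := by linarith [h1.2, h2.1]
    exact_mod_cast this
  obtain rfl | rfl : n = 0 ∨ n = 1 := by omega
  · left; simpa using hb
  · right; exact ⟨b, hb, by simp⟩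

section Translates

variable {e : ℝ ≃o ℝ}

/-- The homeomorphism `eᵏ + m` of the line. -/
def liftAct (e : ℝ ≃o ℝ) (k m : ℤ) (x : ℝ) : ℝ := (e ^ k) x + m

lemma zpow_apply_add_int (he : ∀ x, e (x + 1) = e x + 1) (k m : ℤ) (x : ℝ) :
    (e ^ k) (x + m) = (e ^ k) x + m := by
  have key : ∀ (m : ℤ) (x : ℝ), e (x + m) = e x + m := by
    intro m
    induction m using Int.induction_on with
    | zero => simp
    | succ n ih =>
      intro x
      have := he (x + n)
      have h2 := ih x
      push_cast at *
      rw [← add_assoc, this, h2, add_assoc]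
    | pred n ih =>
      intro x
      have := he (x + (-n - 1))
      have h2 := ih x
      push_cast at *
      rw [show x + (-(n : ℝ) - 1) + 1 = x + -n by ring, h2] at this
      linarith
  have hc : Commute e (OrderIso.addRight (m : ℝ)) := by
    ext y
    simp [key]
  have := DFunLike.congr_fun (hc.zpow_left k).eq x
  simpa using this

lemma liftAct_lt_iff (k m : ℤ) (x y : ℝ) : liftAct e k m x < liftAct e k m y ↔ x < y := by
  simp [liftAct]

lemma liftAct_le_iff (k m : ℤ) (x y : ℝ) : liftAct e k m x ≤ liftAct e k m y ↔ x ≤ y := by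
  simp [liftAct]

lemma continuous_liftAct (k m : ℤ) : Continuous (liftAct e k m) :=
  (e ^ k).continuous.add continuous_const

lemma liftAct_liftAct (he : ∀ x, e (x + 1) = e x + 1) (k m k' m' : ℤ) (x : ℝ) :
    liftAct e k m (liftAct e k' m' x) = liftAct e (k + k') (m + m') x := by
  simp only [liftAct, zpow_apply_add_int he, zpow_add]
  push_cast
  have hmul : (e ^ k * e ^ k') x = (e ^ k) ((e ^ k') x) := rfl
  rw [hmul]
  ring

@[simp] lemma liftAct_zero_left (m : ℤ) (x : ℝ) : liftAct e 0 m x = x + m := by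
  simp [liftAct]

lemma liftAct_lt_liftAct_iff (he : ∀ x, e (x + 1) = e x + 1) (k m k' m' : ℤ) (x y : ℝ) :
    liftAct e k m x < liftAct e k' m' y ↔ x < liftAct e (k' - k) (m' - m) y := by
  rw [← liftAct_lt_iff (e := e) k m x, liftAct_liftAct he, add_sub_cancel, add_sub_cancel]

lemma liftAct_eq_liftAct_iff (he : ∀ x, e (x + 1) = e x + 1) (k m k' m' : ℤ) (x y : ℝ) :
    liftAct e k m x = liftAct e k' m' y ↔ x = liftAct e (k' - k) (m' - m) y := by
  constructor
  · intro h
    have := congrArg (liftAct e (-k) (-m)) h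
    simp only [liftAct_liftAct he] at this
    simpa [neg_add_eq_sub] using this
  · rintro rfl
    simp [liftAct_liftAct he]

lemma iterate_liftAct (he : ∀ x, e (x + 1) = e x + 1) (k m : ℤ) (n : ℕ) (x : ℝ) :
    (liftAct e k m)^[n] x = liftAct e (n * k) (n * m) x := by
  induction n with
  | zero => simp
  | succ n ih =>
    rw [Function.iterate_succ_apply', ih, liftAct_liftAct he]
    congr 1 <;> push_cast <;> ring

/-- If no point is periodic, the orbit of `a` has no nearest point to the right of `a`. -/
lemma exists_orbit_point_between (he : ∀ x, e (x + 1) = e x + 1)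
    (hfree : ∀ k m x, k ≠ 0 → liftAct e k m x ≠ x) (a : ℝ) {k₀ m₀ : ℤ} (hk₀ : k₀ ≠ 0)
    (h₀ : a < liftAct e k₀ m₀ a) :
    ∃ k m : ℤ, k ≠ 0 ∧ a < liftAct e k m a ∧ liftAct e k m a < liftAct e k₀ m₀ a := by
  by_contra! hcon
  set g := liftAct e k₀ m₀ with hg
  have hmono : Monotone g := fun x y h => (liftAct_le_iff _ _ _ _).2 h
  have hiter : Monotone fun n : ℕ => g^[n] a :=
    hmono.monotone_iterate_of_le_map h₀.le
  have hunb : ∃ n : ℕ, a + 1 < g^[n] a := by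
    by_contra! hb
    have hlim := tendsto_atTop_ciSup hiter ⟨a + 1, by rintro _ ⟨n, rfl⟩; exact hb n⟩
    have := isFixedPt_of_tendsto_iterate hlim (continuous_liftAct k₀ m₀).continuousAt
    exact hfree _ _ _ hk₀ this
  classical
  obtain ⟨n, hn⟩ : ∃ n, Nat.find hunb = n + 1 := by
    refine Nat.exists_eq_succ_of_ne_zero fun h => ?_
    have := Nat.find_spec hunb
    rw [h] at this
    simp at this
    linarith
  have h1 : a + 1 < g^[n + 1] a := hn ▸ Nat.find_spec hunb
  have h2 : g^[n] a ≤ a + 1 := not_lt.1 (Nat.find_min hunb (by omega))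
  rw [hg, iterate_liftAct he] at h1 h2
  have e1 : a + 1 = liftAct e 0 1 a := by simp
  rw [e1] at h1 h2
  have h3 : liftAct e (0 - n * k₀) (1 - n * m₀) a < liftAct e k₀ m₀ a := by
    rw [liftAct_lt_liftAct_iff he] at h1 ⊢
    convert h1 using 2 <;> push_cast <;> ring
  have h4 : a ≤ liftAct e (0 - n * k₀) (1 - n * m₀) a := by
    rw [← not_lt, ← liftAct_lt_iff (n * k₀ : ℤ) (n * m₀ : ℤ), liftAct_liftAct he, not_lt,
      add_sub_cancel, add_sub_cancel]
    exact h2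
  rcases eq_or_ne n 0 with rfl | hn0
  · -- here `a + 1 < g a`, so a translate of `g a` lies strictly between
    simp at h3
    have h5 := hcon k₀ (m₀ - 1) hk₀ (by simp [liftAct] at h3 ⊢; linarith)
    simp [hg, liftAct] at h5
    linarith
  · have hne : (0 - n * k₀ : ℤ) ≠ 0 := by
      simp [hn0, hk₀]
    have h5 := hcon _ _ hne (lt_of_le_of_ne h4 (hfree _ _ _ hne).symm)
    exact absurd h3 (not_lt.2 h5)

/-- Closest one-sided returns occur at arbitrarily large times. -/
lemma exists_closest_return (he : ∀ x, e (x + 1) = e x + 1)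
    (hfree : ∀ k m x, k ≠ 0 → liftAct e k m x ≠ x) (a : ℝ) (N : ℕ) :
    ∃ p m : ℤ, N < p.natAbs ∧ a < liftAct e p m a ∧
      ∀ k n : ℤ, k ≠ 0 → k.natAbs < p.natAbs → a ≤ liftAct e k n a →
        liftAct e p m a ≤ liftAct e k n a := by
  have hbeat : ∃ q : ℕ, ∃ p m : ℤ, p.natAbs = q ∧ p ≠ 0 ∧ a < liftAct e p m a ∧
      ∀ k n : ℤ, k ≠ 0 → k.natAbs ≤ N → a < liftAct e k n a →
        liftAct e p m a < liftAct e k n a := by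
    suffices h : ∀ T : Finset ℤ, ∃ p m : ℤ, p ≠ 0 ∧ a < liftAct e p m a ∧
        ∀ k ∈ T, ∀ n : ℤ, k ≠ 0 → a < liftAct e k n a → liftAct e p m a < liftAct e k n a by
      obtain ⟨p, m, h0, h1, h2⟩ := h (Finset.Icc (-N) N)
      exact ⟨_, p, m, rfl, h0, h1, fun k n hk hkN => h2 k (by simp; omega) n hk⟩
    intro T
    induction T using Finset.induction_on with
    | empty =>
      refine ⟨1, ⌊a - e a⌋ + 1, one_ne_zero, ?_, by simp⟩
      have := Int.lt_floor_add_one (a - e a)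
      simp [liftAct]
      linarith
    | insert k₁ T _ ih =>
      obtain ⟨p, m, h0, h1, h2⟩ := ih
      rcases eq_or_ne k₁ 0 with rfl | hk₁
      · refine ⟨p, m, h0, h1, fun k hk n hk0 => ?_⟩
        exact h2 k ((Finset.mem_insert.1 hk).resolve_left hk0) n hk0
      -- the nearest translate of the new orbit point
      set n₁ : ℤ := ⌊a - (e ^ k₁) a⌋ + 1 with hn₁
      have hpos : a < liftAct e k₁ n₁ a := by
        have := Int.lt_floor_add_one (a - (e ^ k₁) a)
        simp [liftAct, hn₁]
        linarith
      have hleast : ∀ n : ℤ, a < liftAct e k₁ n a → liftAct e k₁ n₁ a ≤ liftAct e k₁ n a := by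
        intro n hn
        have : n₁ ≤ n := by
          rw [hn₁, Int.add_one_le_iff, Int.floor_lt]
          simp [liftAct] at hn
          linarith
        simpa [liftAct] using this
      rcases lt_or_ge (liftAct e p m a) (liftAct e k₁ n₁ a) with hlt | hge
      · refine ⟨p, m, h0, h1, fun k hk n hk0 hn => ?_⟩
        rcases Finset.mem_insert.1 hk with rfl | hk
        · exact hlt.trans_le (hleast n hn)
        · exact h2 k hk n hk0 hn
      · obtain ⟨p', m', h0', h1', h2'⟩ := exists_orbit_point_between he hfree a hk₁ hpos
        refine ⟨p', m', h0', h1', fun k hk n hk0 hn => ?_⟩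
        rcases Finset.mem_insert.1 hk with rfl | hk
        · exact h2'.trans_le (hleast n hn)
        · exact (h2'.trans_le hge).trans (h2 k hk n hk0 hn)
  classical
  obtain ⟨p, m, hp, h0, h1, h2⟩ := Nat.find_spec hbeat
  refine ⟨p, m, ?_, h1, ?_⟩
  · by_contra hle
    exact lt_irrefl _ (h2 p m h0 (not_lt.1 hle) h1)
  · intro k n hk hkp hle
    by_contra! hlt
    refine Nat.find_min hbeat (hp ▸ hkp) ⟨k, n, rfl, hk, ?_, fun k' n' hk' hN hlt' => ?_⟩
    · exact lt_of_le_of_ne hle (hfree _ _ _ hk).symm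
    · have hbeaten := h2 k' n' hk' hN hlt'
      exact hlt.trans hbeaten

/-- A non-dense orbit yields an orbit that is isolated from the right. -/
lemma exists_right_isolated (he : ∀ x, e (x + 1) = e x + 1) {z : ℝ}
    (hz : ¬ Dense {y : ℝ | ∃ k m : ℤ, liftAct e k m z = y}) :
    ∃ a b : ℝ, a < b ∧ ∀ k m : ℤ, a < liftAct e k m a → b < liftAct e k m a := by
  set O := {y : ℝ | ∃ k m : ℤ, liftAct e k m z = y} with hO
  rw [dense_iff_exists_between] at hz
  push Not at hz
  obtain ⟨c, d, hcd, hgap⟩ := hz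
  have hne : (O ∩ Set.Iic c).Nonempty := by
    refine ⟨z + (⌊c - z⌋ : ℤ), ⟨0, ⌊c - z⌋, by simp⟩, ?_⟩
    have := Int.floor_le (c - z)
    simp only [Set.mem_Iic]
    linarith
  have hbdd : BddAbove (O ∩ Set.Iic c) := ⟨c, fun y hy => hy.2⟩
  set a := sSup (O ∩ Set.Iic c) with ha
  have hac : a ≤ c := csSup_le hne fun y hy => hy.2
  have haO : a ∈ closure O :=
    closure_mono Set.inter_subset_left (csSup_mem_closure hne hbdd)
  refine ⟨a, (a + d) / 2, by linarith, fun k m hkm => ?_⟩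
  have hd : d ≤ liftAct e k m a := by
    by_contra! hlt
    have hmem : liftAct e k m a ∈ closure O := by
      refine map_mem_closure (continuous_liftAct k m) haO ?_
      rintro _ ⟨k', m', rfl⟩
      exact ⟨_, _, (liftAct_liftAct he k m k' m' z).symm⟩
    obtain ⟨y, ⟨hy1, hy2⟩, hyO⟩ := mem_closure_iff.1 hmem (Set.Ioo a d) isOpen_Ioo ⟨hkm, hlt⟩
    rcases le_or_gt y c with hyc | hyc
    · exact absurd (le_csSup hbdd ⟨hyO, hyc⟩) (not_le.2 hy1)
    · exact absurd hy2 (not_lt.2 (hgap y hyO hyc))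
  linarith

end Translates

section WanderingInterval

variable {e : ℝ ≃o ℝ} {a b : ℝ}

lemma index_eq_of_mem_translates (he : ∀ x, e (x + 1) = e x + 1)
    (hfree : ∀ k m x, k ≠ 0 → liftAct e k m x ≠ x)
    (hW : ∀ k m : ℤ, a < liftAct e k m a → b < liftAct e k m a) {i j m n : ℤ} {y : ℝ}
    (h₁ : y ∈ Set.Icc (liftAct e i m a) (liftAct e i m b))
    (h₂ : y ∈ Set.Icc (liftAct e j n a) (liftAct e j n b)) : i = j := by
  rcases lt_trichotomy (liftAct e i m a) (liftAct e j n a) with h | h | h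
  · rw [liftAct_lt_liftAct_iff he] at h
    have := (liftAct_lt_liftAct_iff he i m j n b a).2 (hW _ _ h)
    linarith [h₁.2, h₂.1]
  · rw [liftAct_eq_liftAct_iff he] at h
    by_contra hne
    exact hfree _ _ _ (sub_ne_zero.2 (Ne.symm hne)) h.symm
  · rw [liftAct_lt_liftAct_iff he] at h
    have := (liftAct_lt_liftAct_iff he j n i m b a).2 (hW _ _ h)
    linarith [h₂.2, h₁.1]

/-- The length of the `k`-th iterate of the interval `[a, b]`. -/
def iterLength (e : ℝ ≃o ℝ) (a b : ℝ) (k : ℤ) : ℝ := (e ^ k) b - (e ^ k) a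

lemma iterLength_pos (hab : a < b) (k : ℤ) : 0 < iterLength e a b k :=
  sub_pos.2 ((e ^ k).strictMono hab)

lemma liftAct_sub_liftAct (k m : ℤ) :
    liftAct e k m b - liftAct e k m a = iterLength e a b k := by
  simp [liftAct, iterLength]

lemma apply_liftAct (he : ∀ x, e (x + 1) = e x + 1) (k m : ℤ) (x : ℝ) :
    e (liftAct e k m x) = liftAct e (k + 1) m x := by
  have := liftAct_liftAct he 1 0 k m x
  simpa [liftAct, add_comm] using this

lemma iterLength_succ (he : ∀ x, e (x + 1) = e x + 1) (k m : ℤ) :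
    iterLength e a b (k + 1) = e (liftAct e k m b) - e (liftAct e k m a) := by
  rw [apply_liftAct he, apply_liftAct he, liftAct_sub_liftAct]

lemma finite_setOf_le_iterLength (he : ∀ x, e (x + 1) = e x + 1)
    (hfree : ∀ k m x, k ≠ 0 → liftAct e k m x ≠ x)
    (hW : ∀ k m : ℤ, a < liftAct e k m a → b < liftAct e k m a) {ε : ℝ} (hε : 0 < ε) :
    {k : ℤ | ε ≤ iterLength e a b k}.Finite := by
  set u : ℤ → ℝ := fun k => Int.fract ((e ^ k) a) with hu
  have hu' : ∀ k, u k = liftAct e k (-⌊(e ^ k) a⌋) a := fun k => by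
    simp [hu, liftAct, Int.fract, sub_eq_add_neg]
  have key : ∀ j k : ℤ, ε ≤ iterLength e a b j → ε ≤ iterLength e a b k → u j ≤ u k →
      u k < u j + ε → j = k := by
    intro j k hj hk hle hlt
    refine index_eq_of_mem_translates he hfree hW (y := u k) (m := -⌊(e ^ j) a⌋)
      (n := -⌊(e ^ k) a⌋) ⟨?_, ?_⟩ ⟨?_, ?_⟩
    · rwa [← hu']
    · have := liftAct_sub_liftAct (e := e) (a := a) (b := b) j (-⌊(e ^ j) a⌋)
      rw [← hu'] at this
      linarith
    · rw [← hu']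
    · have := liftAct_sub_liftAct (e := e) (a := a) (b := b) k (-⌊(e ^ k) a⌋)
      rw [← hu'] at this
      linarith
  refine Set.Finite.of_injOn (f := fun k => ⌊u k / ε⌋) (t := Set.Icc 0 ⌊1 / ε⌋) ?_ ?_
    (Set.finite_Icc _ _)
  · intro k _
    have h0 : 0 ≤ u k := Int.fract_nonneg _
    have h1 : u k ≤ 1 := (Int.fract_lt_one _).le
    exact ⟨Int.floor_nonneg.2 (by positivity), Int.floor_le_floor (by gcongr)⟩
  · intro j hj k hk hjk
    have habs := Int.abs_sub_lt_one_of_floor_eq_floor hjk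
    rw [← sub_div, abs_div, abs_of_pos hε, div_lt_one hε, abs_lt] at habs
    rcases le_total (u j) (u k) with h | h
    · exact key j k hj hk h (by linarith)
    · exact (key k j hk hj h (by linarith)).symm

lemma index_eq_of_mem_hulls (he : ∀ x, e (x + 1) = e x + 1) {p m : ℤ}
    (hp : ∀ k n : ℤ, k ≠ 0 → k.natAbs < p.natAbs → a ≤ liftAct e k n a →
      liftAct e p m a ≤ liftAct e k n a) {i j s t : ℤ} {y : ℝ}
    (hij : (i - j).natAbs < p.natAbs)
    (h₁ : y ∈ Set.Ico (liftAct e i s a) (liftAct e (i + p) (s + m) a))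
    (h₂ : y ∈ Set.Ico (liftAct e j t a) (liftAct e (j + p) (t + m) a)) : i = j := by
  have key : ∀ i j s t : ℤ, i ≠ j → (j - i).natAbs < p.natAbs →
      liftAct e i s a ≤ liftAct e j t a →
      liftAct e (i + p) (s + m) a ≤ liftAct e j t a := by
    intro i j s t hne hlt hle
    rw [← not_lt, liftAct_lt_liftAct_iff he, not_lt] at hle ⊢
    have e1 : liftAct e (i - j) (s - t) (liftAct e (j - i) (t - s) a) = a := by
      rw [liftAct_liftAct he]; simp
    have hle' : a ≤ liftAct e (j - i) (t - s) a := by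
      rw [← liftAct_le_iff (e := e) (i - j) (s - t), e1]
      exact hle
    have := hp _ _ (sub_ne_zero.2 hne.symm) hlt hle'
    rw [← liftAct_le_iff (e := e) (i - j) (s - t), e1, liftAct_liftAct he] at this
    rwa [show i + p - j = i - j + p by ring, show s + m - t = s - t + m by ring]
  by_contra hne
  rcases le_total (liftAct e i s a) (liftAct e j t a) with h | h
  · have := key i j s t hne (by omega) h
    linarith [h₁.2, h₂.1]
  · have := key j i t s (Ne.symm hne) hij h
    linarith [h₂.2, h₁.1]

lemma exists_break_of_ratio_ne (he : ∀ x, e (x + 1) = e x + 1) {B : Set ℝ}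
    (hPA : PiecewiseAffineLift e B) (hab : a < b)
    (hW : ∀ k m : ℤ, a < liftAct e k m a → b < liftAct e k m a) {p m : ℤ}
    (hpa : a < liftAct e p m a) {i : ℤ}
    (hi : iterLength e a b (i + 1) / iterLength e a b i ≠
      iterLength e a b (i + p + 1) / iterLength e a b (i + p)) :
    ∃ c ∈ B, ∃ n : ℤ,
      c ∈ Set.Ico (liftAct e i n a) (liftAct e (i + p) (n + m) a) ∨
      c ∈ Set.Icc (liftAct e (i + p) (n + m) a) (liftAct e (i + p) (n + m) b) := by
  have h1 : liftAct e i 0 a < liftAct e i 0 b := (liftAct_lt_iff _ _ _ _).2 hab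
  have h2 : liftAct e i 0 b < liftAct e (i + p) m a := by
    rw [liftAct_lt_liftAct_iff he]
    simpa using hW _ _ hpa
  have h3 : liftAct e (i + p) m a < liftAct e (i + p) m b := (liftAct_lt_iff _ _ _ _).2 hab
  have hmeet : ¬ Disjoint (Set.Icc (liftAct e i 0 a) (liftAct e (i + p) m b))
      (BreakLattice B) := by
    intro hd
    obtain ⟨α, γ, haff⟩ := hPA _ isPreconnected_Icc hd
    have r1 : iterLength e a b (i + 1) = α * iterLength e a b i := by
      rw [iterLength_succ he i 0, ← liftAct_sub_liftAct i 0, haff _ ⟨h1.le, by linarith⟩,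
        haff _ ⟨le_rfl, by linarith⟩]
      ring
    have r2 : iterLength e a b (i + p + 1) = α * iterLength e a b (i + p) := by
      rw [iterLength_succ he (i + p) m, ← liftAct_sub_liftAct (i + p) m,
        haff _ ⟨by linarith, le_rfl⟩, haff _ ⟨by linarith, h3.le⟩]
      ring
    rw [r1, r2, mul_div_cancel_right₀ _ (iterLength_pos hab _).ne',
      mul_div_cancel_right₀ _ (iterLength_pos hab _).ne'] at hi
    exact hi rfl
  obtain ⟨_, ⟨hz1, hz2⟩, c, hc, n, rfl⟩ := Set.not_disjoint_iff.1 hmeet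
  refine ⟨c, hc, -n, ?_⟩
  simp only [liftAct, Set.mem_Ico, Set.mem_Icc] at hz1 hz2 ⊢
  push_cast at hz1 hz2 ⊢
  rcases lt_or_ge c ((e ^ (i + p)) a + (-n + m)) with h | h
  · exact Or.inl ⟨by linarith, h⟩
  · exact Or.inr ⟨h, by linarith⟩

lemma card_ratio_ne_le (he : ∀ x, e (x + 1) = e x + 1)
    (hfree : ∀ k m x, k ≠ 0 → liftAct e k m x ≠ x) (hab : a < b)
    (hW : ∀ k m : ℤ, a < liftAct e k m a → b < liftAct e k m a) {B : Set ℝ} (hBfin : B.Finite)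
    (hPA : PiecewiseAffineLift e B) {p m : ℤ} (hpa : a < liftAct e p m a)
    (hp : ∀ k n : ℤ, k ≠ 0 → k.natAbs < p.natAbs → a ≤ liftAct e k n a →
      liftAct e p m a ≤ liftAct e k n a) (T : Finset ℤ)
    (hT : ∀ i ∈ T, ∀ j ∈ T, (i - j).natAbs < p.natAbs)
    (hbad : ∀ i ∈ T, iterLength e a b (i + 1) / iterLength e a b i ≠
      iterLength e a b (i + p + 1) / iterLength e a b (i + p)) :
    T.card ≤ hBfin.toFinset.card * 2 := by
  classical
  set hull : ℝ → Finset ℤ := fun c => T.filter fun i => ∃ n : ℤ,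
    c ∈ Set.Ico (liftAct e i n a) (liftAct e (i + p) (n + m) a)
  set last : ℝ → Finset ℤ := fun c => T.filter fun i => ∃ n : ℤ,
    c ∈ Set.Icc (liftAct e (i + p) (n + m) a) (liftAct e (i + p) (n + m) b)
  have hsub : T ⊆ hBfin.toFinset.biUnion fun c => hull c ∪ last c := by
    intro i hi
    obtain ⟨c, hc, n, h | h⟩ := exists_break_of_ratio_ne he hPA hab hW hpa (hbad i hi)
    · exact Finset.mem_biUnion.2 ⟨c, by simpa using hc,
        Finset.mem_union_left _ (Finset.mem_filter.2 ⟨hi, n, h⟩)⟩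
    · exact Finset.mem_biUnion.2 ⟨c, by simpa using hc,
        Finset.mem_union_right _ (Finset.mem_filter.2 ⟨hi, n, h⟩)⟩
  refine (Finset.card_le_card hsub).trans (Finset.card_biUnion_le_card_mul _ _ _ fun c _ => ?_)
  have h1 : (hull c).card ≤ 1 := Finset.card_le_one.2 fun i hi j hj => by
    obtain ⟨hi, s, hs⟩ := Finset.mem_filter.1 hi
    obtain ⟨hj, t, ht⟩ := Finset.mem_filter.1 hj
    exact index_eq_of_mem_hulls he hp (hT i hi j hj) hs ht
  have h2 : (last c).card ≤ 1 := Finset.card_le_one.2 fun i hi j hj => by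
    obtain ⟨hi, s, hs⟩ := Finset.mem_filter.1 hi
    obtain ⟨hj, t, ht⟩ := Finset.mem_filter.1 hj
    exact add_right_cancel (index_eq_of_mem_translates he hfree hW hs ht)
  exact (Finset.card_union_le _ _).trans (by omega)

end WanderingInterval

lemma pow_le_prod_of_card_ne_one_le {ι : Type*} (s : Finset ι) (t : ι → ℝ) {κ : ℝ} (hκ0 : 0 < κ)
    (hκ1 : κ ≤ 1) {M : ℕ} (ht : ∀ i ∈ s, κ ≤ t i) (hM : {i ∈ s | t i ≠ 1}.card ≤ M) :
    κ ^ M ≤ ∏ i ∈ s, t i := by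
  classical
  calc κ ^ M ≤ κ ^ {i ∈ s | t i ≠ 1}.card := pow_le_pow_of_le_one hκ0.le hκ1 hM
    _ = ∏ i ∈ s with t i ≠ 1, κ := (Finset.prod_const κ).symm
    _ ≤ ∏ i ∈ s with t i ≠ 1, t i :=
      Finset.prod_le_prod (fun _ _ => hκ0.le) fun i hi => ht i (Finset.mem_filter.1 hi).1
    _ = ∏ i ∈ s, t i := Finset.prod_filter_ne_one s

lemma prod_range_ratio (g : ℕ → ℝ) (hg : ∀ n, g n ≠ 0) (n : ℕ) :
    ∏ j ∈ Finset.range n, g (j + 1) / g j = g n / g 0 := by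
  induction n with
  | zero => simp [hg 0]
  | succ n ih =>
    rw [Finset.prod_range_succ, ih, mul_comm, div_mul_div_cancel₀ (hg n)]

/-- Denjoy's theorem for piecewise affine lifts: a lift without periodic points has no
interval on the right of a point which is disjoint from the orbit of that point. -/
lemma not_right_isolated {e : ℝ ≃o ℝ} {a b : ℝ} {B : Set ℝ} (hBfin : B.Finite)
    (hB : B ⊆ Set.Ico (0 : ℝ) 1) (hlift : IsLift e) (hPA : PiecewiseAffineLift e B)
    (hfree : ∀ k m x, k ≠ 0 → liftAct e k m x ≠ x) (hab : a < b)
    (hW : ∀ k m : ℤ, a < liftAct e k m a → b < liftAct e k m a) : False := by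
  classical
  have he := hlift.2.2
  obtain ⟨l, hl, u, hlu⟩ := hPA.exists_slope_bounds hBfin hB hlift
  have hpos : ∀ k, 0 < iterLength e a b k := iterLength_pos hab
  set r : ℤ → ℝ := fun k => iterLength e a b (k + 1) / iterLength e a b k with hr
  have hlt1 : ∀ k, iterLength e a b k < 1 := by
    intro k
    have h1 : b < liftAct e 0 1 a := hW 0 1 (by simp)
    have h2 := (liftAct_lt_iff (e := e) k 0 _ _).2 h1
    rw [liftAct_liftAct he] at h2
    simp [liftAct] at h2
    simp only [iterLength]
    linarith
  have hbound : ∀ k, l ≤ r k ∧ r k ≤ u := by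
    intro k
    have hk := liftAct_sub_liftAct (e := e) (a := a) (b := b) k (-⌊(e ^ k) a⌋)
    have hfr : liftAct e k (-⌊(e ^ k) a⌋) a = Int.fract ((e ^ k) a) := by
      simp [liftAct, Int.fract, sub_eq_add_neg]
    have h0 := Int.fract_nonneg ((e ^ k) a)
    have h1 := Int.fract_lt_one ((e ^ k) a)
    have := hlu (liftAct e k (-⌊(e ^ k) a⌋) a) (liftAct e k (-⌊(e ^ k) a⌋) b)
      (by linarith) (by linarith [hpos k]) (by linarith [hlt1 k])
    rw [← iterLength_succ he, hk] at this
    simp only [hr]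
    rw [le_div_iff₀ (hpos k), div_le_iff₀ (hpos k)]
    exact this
  have hrpos : ∀ k, 0 < r k := fun k => hl.trans_le (hbound k).1
  have hu : 0 < u := (hrpos 0).trans_le (hbound 0).2
  have hκ0 : 0 < l / u := div_pos hl hu
  have hκ1 : l / u ≤ 1 := (div_le_one hu).2 ((hbound 0).1.trans (hbound 0).2)
  set C : ℝ := (l / u) ^ (hBfin.toFinset.card * 2) with hC
  have hC0 : 0 < C := pow_pos hκ0 _
  have hC1 : C ≤ 1 := pow_le_one₀ hκ0.le hκ1
  obtain ⟨N, hN⟩ : ∃ N : ℕ, ∀ k : ℤ, N < k.natAbs →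
      iterLength e a b k < C * iterLength e a b 0 := by
    have hfin := finite_setOf_le_iterLength he hfree hW (mul_pos hC0 (hpos 0))
    obtain ⟨N, hN⟩ := (hfin.image Int.natAbs).bddAbove
    refine ⟨N, fun k hk => ?_⟩
    by_contra! hle
    exact absurd (hN ⟨k, hle, rfl⟩) (not_le.2 hk)
  obtain ⟨p, m, hpN, hpa, hp⟩ := exists_closest_return he hfree a N
  set q := p.natAbs with hq
  have hcard : ((Finset.range q).filter fun j : ℕ => r j / r (j - q) ≠ 1).card ≤ hBfin.toFinset.card * 2 := by
    obtain ⟨s, hs⟩ : ∃ s : ℤ, ∀ j : ℕ, r j / r (j - q) ≠ 1 → r (j + s) ≠ r (j + s + p) := by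
      rcases le_total 0 p with h | h
      · refine ⟨-q, fun j hj heq => hj ?_⟩
        rw [show (j : ℤ) + -q + p = j by omega] at heq
        rw [sub_eq_add_neg, heq, div_self (hrpos _).ne']
      · refine ⟨0, fun j hj heq => hj ?_⟩
        rw [show (j : ℤ) + 0 + p = j - q by omega, add_zero] at heq
        rw [heq, div_self (hrpos _).ne']
    rw [← Finset.card_image_of_injective (f := fun j : ℕ => (j : ℤ) + s) _
      (fun i j h => by simpa using h)]
    refine card_ratio_ne_le he hfree hab hW hBfin hPA hpa hp _ ?_ ?_
    · intro i hi j hj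
      simp only [Finset.mem_image, Finset.mem_filter, Finset.mem_range] at hi hj
      omega
    · intro i hi
      simp only [Finset.mem_image, Finset.mem_filter] at hi
      obtain ⟨j, ⟨-, hj⟩, rfl⟩ := hi
      exact hs j hj
  have hprod : C ≤ ∏ j ∈ Finset.range q, r j / r (j - q) := by
    refine pow_le_prod_of_card_ne_one_le _ (fun j : ℕ => r j / r (j - q)) hκ0 hκ1
      (fun j _ => ?_) hcard
    exact div_le_div₀ (hrpos _).le (hbound _).1 (hrpos _) (hbound _).2
  have t1 : ∏ j ∈ Finset.range q, r j = iterLength e a b q / iterLength e a b 0 := by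
    have := prod_range_ratio (fun j : ℕ => iterLength e a b j) (fun j => (hpos _).ne') q
    simpa only [Nat.cast_add, Nat.cast_one, Nat.cast_zero] using this
  have t2 : ∏ j ∈ Finset.range q, r (j - q) = iterLength e a b 0 / iterLength e a b (-q) := by
    have := prod_range_ratio (fun j : ℕ => iterLength e a b (j - q)) (fun j => (hpos _).ne') q
    simpa only [hr, sub_add_eq_add_sub, Nat.cast_add, Nat.cast_one, Nat.cast_zero, sub_self,
      zero_sub] using this
  rw [Finset.prod_div_distrib, t1, t2, div_div_div_eq,
    le_div_iff₀ (mul_pos (hpos _) (hpos _))] at hprod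
  have hq1 := hN q (by simpa using hpN)
  have hq2 := hN (-q) (by simpa using hpN)
  have hlt := mul_lt_mul'' hq1 hq2 (hpos _).le (hpos _).le
  have hsq : C * (iterLength e a b 0 * iterLength e a b 0) * C ≤
      C * (iterLength e a b 0 * iterLength e a b 0) :=
    mul_le_of_le_one_right (mul_pos hC0 (mul_pos (hpos 0) (hpos 0))).le hC1
  nlinarith

lemma IsLift.surjective {F : ℝ → ℝ} (hF : IsLift F) : Function.Surjective F := by
  have hnat : ∀ (n : ℕ) (x : ℝ), F (x + n) = F x + n := by
    intro n
    induction n with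
    | zero => simp
    | succ n ih =>
      intro x
      push_cast
      rw [← add_assoc, hF.2.2, ih, add_assoc]
  intro y
  refine mem_range_of_exists_le_of_exists_ge hF.1 ?_ ?_
  · obtain ⟨n, hn⟩ := exists_nat_ge (F 0 - y)
    refine ⟨0 - n, ?_⟩
    have := hnat n (0 - n)
    rw [sub_add_cancel] at this
    linarith
  · obtain ⟨n, hn⟩ := exists_nat_ge (y - F 0)
    refine ⟨0 + n, ?_⟩
    rw [hnat]
    linarith

lemma Induces.iterate_coe {F : ℝ → ℝ} {f : Circle1 → Circle1} (hf : Induces F f) (n : ℕ)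
    (x : ℝ) : f^[n] (x : Circle1) = ((F^[n] x : ℝ) : Circle1) := by
  induction n generalizing x with
  | zero => rfl
  | succ n ih => rw [Function.iterate_succ_apply, Function.iterate_succ_apply, hf, ih]

lemma coe_add_intCast (x : ℝ) (m : ℤ) : ((x + m : ℝ) : Circle1) = x := by
  simp

lemma OrderIso.coe_pow_eq_iterate (e : ℝ ≃o ℝ) (n : ℕ) (x : ℝ) : (e ^ n) x = e^[n] x := by
  induction n generalizing x with
  | zero => rfl
  | succ n ih => rw [pow_succ, Function.iterate_succ_apply, ← ih]; rfl

/-- A piecewise affine orientation-preserving circle homeomorphism with finitely many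
break points either has a periodic point or is minimal. -/
theorem piecewise_affine_periodic_or_minimal
    (F : ℝ → ℝ) (f : Circle1 → Circle1) (B : Set ℝ)
    (hBfin : B.Finite) (hB : B ⊆ Set.Ico (0 : ℝ) 1)
    (hF : IsLift F) (hPA : PiecewiseAffineLift F B) (hf : Induces F f) :
    (∃ x : Circle1, ∃ q : ℕ, 1 ≤ q ∧ f^[q] x = x) ∨ MinimalCircleMap f := by
  by_contra! hcon
  obtain ⟨hper, hmin⟩ := hcon
  obtain ⟨e, rfl⟩ : ∃ e : ℝ ≃o ℝ, ⇑e = F :=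
    ⟨hF.2.1.orderIsoOfSurjective F hF.surjective, rfl⟩
  have he := hF.2.2
  have hiter : ∀ (n : ℕ) (m : ℤ) (x : ℝ),
      f^[n] (x : Circle1) = ((liftAct e n m x : ℝ) : Circle1) := by
    intro n m x
    rw [hf.iterate_coe, liftAct, coe_add_intCast, zpow_natCast, OrderIso.coe_pow_eq_iterate]
  have hinv : ∀ (k m : ℤ) (x : ℝ), liftAct e (-k) (-m) (liftAct e k m x) = x := by
    intro k m x
    rw [liftAct_liftAct he]
    simp
  have hfree : ∀ k m x, k ≠ 0 → liftAct e k m x ≠ x := by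
    intro k m x hk hx
    obtain ⟨n, rfl | rfl⟩ := k.eq_nat_or_neg
    · exact hper x n (by omega) (by rw [hiter n m, hx])
    · refine hper x n (by omega) ?_
      have := hinv (-n) m x
      rw [hx, neg_neg] at this
      rw [hiter n (-m), this]
  refine hmin fun x => ?_
  obtain ⟨z, rfl⟩ := QuotientAddGroup.mk_surjective x
  by_contra hnd
  have hO : ¬ Dense {y : ℝ | ∃ k m : ℤ, liftAct e k m z = y} := by
    refine fun hd => hnd ?_
    refine ((QuotientAddGroup.mk_surjective.denseRange.dense_image
      (AddCircle.continuous_mk' 1) hd)).mono ?_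
    rintro _ ⟨_, ⟨k, m, rfl⟩, rfl⟩
    obtain ⟨n, rfl | rfl⟩ := k.eq_nat_or_neg
    · exact ⟨n, Or.inl (hiter n m z)⟩
    · refine ⟨n, Or.inr ?_⟩
      have := hinv (-n) m z
      rw [neg_neg] at this
      exact (hiter n (-m) _).trans (by rw [this])
  obtain ⟨a, b, hab, hW⟩ := exists_right_isolated he hO
  exact not_right_isolated hBfin hB hF hPA hfree hab hW
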